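/- Let (X,T) be a nonautonomous dynamical system and K ⊂ X_0 a non-empty compact set. Then the Bowen topological entropy satisfies h^B(T,K) = sup{ h̲_μ(T) : μ is a Borel probability measure on X_0 with μ(K) = 1 }. -/

import Mathlib

open Filter MeasureTheory Set
open scoped ENNReal Topology

namespace NDS

variable {X : ℕ → Type*}

/-- Iterates `T^j : X 0 → X j` of a nonautonomous dynamical system `T`. -/
def iter (T : ∀ k, X k → X (k + 1)) : ∀ j, X 0 → X j
  | 0 => fun x => x
  | j + 1 => fun x => T j (iter T j x)

/-- The Birkhoff-type sum `S_n^T f (x) = ∑_{j<n} f_j (T^j x)`. -/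
def birk (T : ∀ k, X k → X (k + 1)) (f : ∀ k, X k → ℝ) (n : ℕ) (x : X 0) : ℝ :=
  ∑ j ∈ Finset.range n, f j (iter T j x)

/-- The uniform norm `‖f‖ = sup_k sup_x |f_k x|` of a sequence of potentials. -/
noncomputable def fnorm (f : ∀ k, X k → ℝ) : ℝ :=
  ⨆ k : ℕ, ⨆ x : X k, |f k x|

/-- `log : ℝ≥0∞ → EReal` with the conventions `log 0 = -∞`, `log ∞ = ∞`. -/
noncomputable def elog (x : ℝ≥0∞) : EReal :=
  if x = 0 then ⊥ else if x = ⊤ then ⊤ else ((Real.log x.toReal : ℝ) : EReal)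

/-- The nonnegative part of an extended real, as an element of `ℝ≥0∞`. -/
noncomputable def toENN (x : EReal) : ℝ≥0∞ :=
  if x = ⊤ then ⊤ else ENNReal.ofReal x.toReal

/-- The canonical map `ℝ≥0∞ → EReal`. -/
noncomputable def ofENN (x : ℝ≥0∞) : EReal :=
  if x = ⊤ then ⊤ else ((x.toReal : ℝ) : EReal)

/-- The integral of an extended-real-valued function: the difference of the lower
integrals of its positive and negative parts. -/
noncomputable def eInt {α : Type*} [MeasurableSpace α] (μ : Measure α) (g : α → EReal) : EReal :=
  ofENN (∫⁻ x, toENN (g x) ∂μ) - ofENN (∫⁻ x, toENN (-g x) ∂μ)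

section Metric

variable [∀ k, MetricSpace (X k)]

/-- The open Bowen ball `B_n^T(x,ε)`. -/
def bowenBall (T : ∀ k, X k → X (k + 1)) (n : ℕ) (ε : ℝ) (x : X 0) : Set (X 0) :=
  {y | ∀ j < n, dist (iter T j x) (iter T j y) < ε}

/-- The closed Bowen ball `B̄_n^T(x,ε)`. -/
def bowenClosedBall (T : ∀ k, X k → X (k + 1)) (n : ℕ) (ε : ℝ) (x : X 0) : Set (X 0) :=
  {y | ∀ j < n, dist (iter T j x) (iter T j y) ≤ ε}

/-- Equicontinuity of a sequence of potentials `f = (f_k)`. -/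
def EquicontPotential (f : ∀ k, X k → ℝ) : Prop :=
  ∀ ε : ℝ, 0 < ε → ∃ δ : ℝ, 0 < δ ∧ ∀ k, ∀ x y : X k, dist x y < δ → |f k x - f k y| < ε

/-- The supremum of the Birkhoff sum `S_n^T f` over a subset `A` of `X 0`. -/
noncomputable def supBirk (T : ∀ k, X k → X (k + 1)) (f : ∀ k, X k → ℝ) (n : ℕ)
    (A : Set (X 0)) : ℝ :=
  ⨆ y : A, birk T f n (y : X 0)

/-- Measure-theoretic lower local pressure `P̲_μ(T,f,x)`. -/
noncomputable def localLowerPres [MeasurableSpace (X 0)] (μ : Measure (X 0))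
    (T : ∀ k, X k → X (k + 1)) (f : ∀ k, X k → ℝ) (x : X 0) : EReal :=
  ⨆ (ε : ℝ) (_ : 0 < ε),
    liminf (fun n : ℕ =>
      (((n : ℝ)⁻¹ : ℝ) : EReal) *
        (-(elog (μ (bowenBall T n ε x))) + ((birk T f n x : ℝ) : EReal))) atTop

/-- Measure-theoretic upper local pressure `P̄_μ(T,f,x)`. -/
noncomputable def localUpperPres [MeasurableSpace (X 0)] (μ : Measure (X 0))
    (T : ∀ k, X k → X (k + 1)) (f : ∀ k, X k → ℝ) (x : X 0) : EReal :=
  ⨆ (ε : ℝ) (_ : 0 < ε),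
    limsup (fun n : ℕ =>
      (((n : ℝ)⁻¹ : ℝ) : EReal) *
        (-(elog (μ (bowenBall T n ε x))) + ((birk T f n x : ℝ) : EReal))) atTop

/-- Measure-theoretic lower local entropy `h̲_μ(T,x)`. -/
noncomputable def localLowerEnt [MeasurableSpace (X 0)] (μ : Measure (X 0))
    (T : ∀ k, X k → X (k + 1)) (x : X 0) : EReal :=
  ⨆ (ε : ℝ) (_ : 0 < ε),
    liminf (fun n : ℕ =>
      (((n : ℝ)⁻¹ : ℝ) : EReal) * (-(elog (μ (bowenBall T n ε x))))) atTop

/-- Measure-theoretic upper local entropy `h̄_μ(T,x)`. -/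
noncomputable def localUpperEnt [MeasurableSpace (X 0)] (μ : Measure (X 0))
    (T : ∀ k, X k → X (k + 1)) (x : X 0) : EReal :=
  ⨆ (ε : ℝ) (_ : 0 < ε),
    limsup (fun n : ℕ =>
      (((n : ℝ)⁻¹ : ℝ) : EReal) * (-(elog (μ (bowenBall T n ε x))))) atTop

/-- Measure-theoretic lower pressure `P̲_μ(T,f) = ∫ P̲_μ(T,f,x) dμ(x)`. -/
noncomputable def lowerPres [MeasurableSpace (X 0)] (μ : Measure (X 0))
    (T : ∀ k, X k → X (k + 1)) (f : ∀ k, X k → ℝ) : EReal :=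
  eInt μ (fun x => localLowerPres μ T f x)

/-- Measure-theoretic upper pressure `P̄_μ(T,f) = ∫ P̄_μ(T,f,x) dμ(x)`. -/
noncomputable def upperPres [MeasurableSpace (X 0)] (μ : Measure (X 0))
    (T : ∀ k, X k → X (k + 1)) (f : ∀ k, X k → ℝ) : EReal :=
  eInt μ (fun x => localUpperPres μ T f x)

/-- Measure-theoretic lower entropy `h̲_μ(T) = ∫ h̲_μ(T,x) dμ(x)`. -/
noncomputable def lowerEnt [MeasurableSpace (X 0)] (μ : Measure (X 0))
    (T : ∀ k, X k → X (k + 1)) : EReal :=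
  eInt μ (fun x => localLowerEnt μ T x)

/-- Measure-theoretic upper entropy `h̄_μ(T) = ∫ h̄_μ(T,x) dμ(x)`. -/
noncomputable def upperEnt [MeasurableSpace (X 0)] (μ : Measure (X 0))
    (T : ∀ k, X k → X (k + 1)) : EReal :=
  eInt μ (fun x => localUpperEnt μ T x)

/-- The Bowen premeasure `M^s_{N,ε}(T,f,Z)`: the infimum of
`∑ exp(-n_i s + S_{n_i}^T f(x_i))` over all countable `(N,ε)`-covers of `Z` by open
Bowen balls `B_{n_i}^T(x_i,ε)` with `n_i ≥ N`. -/
noncomputable def bowenPre (T : ∀ k, X k → X (k + 1)) (f : ∀ k, X k → ℝ)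
    (s : ℝ) (N : ℕ) (ε : ℝ) (Z : Set (X 0)) : ℝ≥0∞ :=
  ⨅ (D : Set (X 0 × ℕ)) (_ : D.Countable) (_ : ∀ p ∈ D, N ≤ p.2)
      (_ : Z ⊆ ⋃ p ∈ D, bowenBall T p.2 ε p.1),
    ∑' p : D, ENNReal.ofReal (Real.exp (-(p.1.2 : ℝ) * s + birk T f p.1.2 p.1.1))

/-- `M^s_ε(T,f,Z) = lim_{N→∞} M^s_{N,ε}(T,f,Z)` (an increasing limit). -/
noncomputable def bowenPreLim (T : ∀ k, X k → X (k + 1)) (f : ∀ k, X k → ℝ)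
    (s : ℝ) (ε : ℝ) (Z : Set (X 0)) : ℝ≥0∞ :=
  ⨆ N : ℕ, bowenPre T f s N ε Z

/-- The critical value `P^B(T,f,Z,ε) = inf {s : M^s_ε(T,f,Z) = 0}`. -/
noncomputable def bowenCrit (T : ∀ k, X k → X (k + 1)) (f : ∀ k, X k → ℝ)
    (ε : ℝ) (Z : Set (X 0)) : EReal :=
  ⨅ (s : ℝ) (_ : bowenPreLim T f s ε Z = 0), (s : EReal)

/-- The Bowen (Pesin–Pitskel') topological pressure
`P^B(T,f,Z) = lim_{ε→0} P^B(T,f,Z,ε)` (an increasing limit as `ε ↓ 0`). -/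
noncomputable def bowenP (T : ∀ k, X k → X (k + 1)) (f : ∀ k, X k → ℝ)
    (Z : Set (X 0)) : EReal :=
  ⨆ (ε : ℝ) (_ : 0 < ε), bowenCrit T f ε Z

/-- The Bowen topological entropy `h^B(T,Z) = P^B(T,0,Z)`. -/
noncomputable def bowenEnt (T : ∀ k, X k → X (k + 1)) (Z : Set (X 0)) : EReal :=
  bowenP T (fun k => fun _ : X k => (0 : ℝ)) Z

/-- The premeasure `N^s_{N,ε}(T,f,Z)` using suprema of Birkhoff sums over the balls. -/
noncomputable def nBowenPre (T : ∀ k, X k → X (k + 1)) (f : ∀ k, X k → ℝ)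
    (s : ℝ) (N : ℕ) (ε : ℝ) (Z : Set (X 0)) : ℝ≥0∞ :=
  ⨅ (D : Set (X 0 × ℕ)) (_ : D.Countable) (_ : ∀ p ∈ D, N ≤ p.2)
      (_ : Z ⊆ ⋃ p ∈ D, bowenBall T p.2 ε p.1),
    ∑' p : D, ENNReal.ofReal
      (Real.exp (-(p.1.2 : ℝ) * s + supBirk T f p.1.2 (bowenBall T p.1.2 ε p.1.1)))

/-- `N^s_ε(T,f,Z) = lim_{N→∞} N^s_{N,ε}(T,f,Z)`. -/
noncomputable def nBowenPreLim (T : ∀ k, X k → X (k + 1)) (f : ∀ k, X k → ℝ)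
    (s : ℝ) (ε : ℝ) (Z : Set (X 0)) : ℝ≥0∞ :=
  ⨆ N : ℕ, nBowenPre T f s N ε Z

/-- The critical value `Q^B(T,f,Z,ε) = inf {s : N^s_ε(T,f,Z) = 0}`. -/
noncomputable def nBowenCrit (T : ∀ k, X k → X (k + 1)) (f : ∀ k, X k → ℝ)
    (ε : ℝ) (Z : Set (X 0)) : EReal :=
  ⨅ (s : ℝ) (_ : nBowenPreLim T f s ε Z = 0), (s : EReal)

/-- The weighted Bowen premeasure `W^s_{N,ε}(T,f,g)`: the infimum of
`∑ c_i exp(-n_i s + sup_{B_{n_i}^T(x_i,ε)} S_{n_i}^T f)` over all countable families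
`{(B_{n_i}^T(x_i,ε), c_i)}` with `0 < c_i`, `n_i ≥ N` and `∑ c_i χ_{B_i} ≥ g`. -/
noncomputable def wBowenPre (T : ∀ k, X k → X (k + 1)) (f : ∀ k, X k → ℝ)
    (s : ℝ) (N : ℕ) (ε : ℝ) (g : X 0 → ℝ) : ℝ≥0∞ :=
  ⨅ (D : Set ((X 0 × ℕ) × ℝ)) (_ : D.Countable)
      (_ : ∀ p ∈ D, N ≤ p.1.2 ∧ 0 < p.2)
      (_ : ∀ x : X 0, ENNReal.ofReal (g x) ≤
        ∑' p : D, (bowenBall T p.1.1.2 ε p.1.1.1).indicator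
          (fun _ => ENNReal.ofReal p.1.2) x),
    ∑' p : D, ENNReal.ofReal p.1.2 *
      ENNReal.ofReal
        (Real.exp (-(p.1.1.2 : ℝ) * s + supBirk T f p.1.1.2 (bowenBall T p.1.1.2 ε p.1.1.1)))

/-- `D` is a countable `(N,ε)`-packing of `Z`: the closed Bowen balls
`B̄_{n}^T(x,ε)`, `(x,n) ∈ D`, are pairwise disjoint with centers in `Z` and orders `≥ N`. -/
def IsPacking (T : ∀ k, X k → X (k + 1)) (N : ℕ) (ε : ℝ) (Z : Set (X 0))
    (D : Set (X 0 × ℕ)) : Prop :=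
  D.Countable ∧ (∀ p ∈ D, p.1 ∈ Z ∧ N ≤ p.2) ∧
    ∀ p ∈ D, ∀ q ∈ D, p ≠ q →
      Disjoint (bowenClosedBall T p.2 ε p.1) (bowenClosedBall T q.2 ε q.1)

/-- The packing premeasure `P^s_{N,ε}(T,f,Z)`: the supremum of
`∑ exp(-n_i s + S_{n_i}^T f(x_i))` over all countable `(N,ε)`-packings of `Z`. -/
noncomputable def packPre (T : ∀ k, X k → X (k + 1)) (f : ∀ k, X k → ℝ)
    (s : ℝ) (N : ℕ) (ε : ℝ) (Z : Set (X 0)) : ℝ≥0∞ :=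
  ⨆ (D : Set (X 0 × ℕ)) (_ : IsPacking T N ε Z D),
    ∑' p : D, ENNReal.ofReal (Real.exp (-(p.1.2 : ℝ) * s + birk T f p.1.2 p.1.1))

/-- `P^s_{∞,ε}(T,f,Z) = lim_{N→∞} P^s_{N,ε}(T,f,Z)` (a decreasing limit). -/
noncomputable def packPreInf (T : ∀ k, X k → X (k + 1)) (f : ∀ k, X k → ℝ)
    (s : ℝ) (ε : ℝ) (Z : Set (X 0)) : ℝ≥0∞ :=
  ⨅ N : ℕ, packPre T f s N ε Z

/-- The packing measure-like quantity
`P^s_ε(T,f,Z) = inf { ∑_i P^s_{∞,ε}(T,f,Z_i) : Z ⊆ ⋃_i Z_i }`. -/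
noncomputable def packMeasure (T : ∀ k, X k → X (k + 1)) (f : ∀ k, X k → ℝ)
    (s : ℝ) (ε : ℝ) (Z : Set (X 0)) : ℝ≥0∞ :=
  ⨅ (Zs : ℕ → Set (X 0)) (_ : Z ⊆ ⋃ i, Zs i), ∑' i, packPreInf T f s ε (Zs i)

/-- The critical value `P^P(T,f,Z,ε) = inf {s : P^s_ε(T,f,Z) = 0}`. -/
noncomputable def packCrit (T : ∀ k, X k → X (k + 1)) (f : ∀ k, X k → ℝ)
    (ε : ℝ) (Z : Set (X 0)) : EReal :=
  ⨅ (s : ℝ) (_ : packMeasure T f s ε Z = 0), (s : EReal)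

/-- The packing topological pressure `P^P(T,f,Z) = lim_{ε→0} P^P(T,f,Z,ε)`. -/
noncomputable def packP (T : ∀ k, X k → X (k + 1)) (f : ∀ k, X k → ℝ)
    (Z : Set (X 0)) : EReal :=
  ⨆ (ε : ℝ) (_ : 0 < ε), packCrit T f ε Z

/-- The packing topological entropy `h^P(T,Z) = P^P(T,0,Z)`. -/
noncomputable def packEnt (T : ∀ k, X k → X (k + 1)) (Z : Set (X 0)) : EReal :=
  packP T (fun k => fun _ : X k => (0 : ℝ)) Z

/-- The packing premeasure `Q^s_{N,ε}(T,f,Z)` using suprema of Birkhoff sums over the balls. -/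
noncomputable def qPackPre (T : ∀ k, X k → X (k + 1)) (f : ∀ k, X k → ℝ)
    (s : ℝ) (N : ℕ) (ε : ℝ) (Z : Set (X 0)) : ℝ≥0∞ :=
  ⨆ (D : Set (X 0 × ℕ)) (_ : IsPacking T N ε Z D),
    ∑' p : D, ENNReal.ofReal
      (Real.exp (-(p.1.2 : ℝ) * s + supBirk T f p.1.2 (bowenClosedBall T p.1.2 ε p.1.1)))

/-- `Q^s_{∞,ε}(T,f,Z) = lim_{N→∞} Q^s_{N,ε}(T,f,Z)`. -/
noncomputable def qPackPreInf (T : ∀ k, X k → X (k + 1)) (f : ∀ k, X k → ℝ)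
    (s : ℝ) (ε : ℝ) (Z : Set (X 0)) : ℝ≥0∞ :=
  ⨅ N : ℕ, qPackPre T f s N ε Z

/-- `Q^s_ε(T,f,Z) = inf { ∑_i Q^s_{∞,ε}(T,f,Z_i) : Z ⊆ ⋃_i Z_i }`. -/
noncomputable def qPackMeasure (T : ∀ k, X k → X (k + 1)) (f : ∀ k, X k → ℝ)
    (s : ℝ) (ε : ℝ) (Z : Set (X 0)) : ℝ≥0∞ :=
  ⨅ (Zs : ℕ → Set (X 0)) (_ : Z ⊆ ⋃ i, Zs i), ∑' i, qPackPreInf T f s ε (Zs i)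

/-- The critical value `Q^P(T,f,Z,ε) = inf {s : Q^s_ε(T,f,Z) = 0}`. -/
noncomputable def qPackCrit (T : ∀ k, X k → X (k + 1)) (f : ∀ k, X k → ℝ)
    (ε : ℝ) (Z : Set (X 0)) : EReal :=
  ⨅ (s : ℝ) (_ : qPackMeasure T f s ε Z = 0), (s : EReal)

end Metric

/-- The distance function of an explicitly given metric space structure. -/
def mdist {α : Type*} (m : MetricSpace α) (x y : α) : ℝ :=
  @dist α m.toPseudoMetricSpace.toDist x y

end NDS

section Duality

open scoped Pointwise CompactlySupported

/-- If a nonnegative family of weights `w` on open sets `U i` has the property that every weighted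
cover of the compact set `K` by finitely many of the `U i` costs at least one, then `K` carries a
probability measure whose value on each `U i` is at most `w i`. -/
theorem exists_measure_le_of_weighted_cover {Y ι : Type*} [MetricSpace Y] [CompactSpace Y]
    [MeasurableSpace Y] [BorelSpace Y] {K : Set Y} (hK : IsCompact K)
    (U : ι → Set Y) (hU : ∀ i, IsOpen (U i)) (hKU : K ⊆ ⋃ i, U i) (w : ι → ℝ) (hw : ∀ i, 0 ≤ w i)
    (hcost : ∀ a : ι →₀ ℝ, (∀ i, 0 ≤ a i) →
      (∀ x ∈ K, 1 ≤ Finsupp.linearCombination ℝ (fun i => (U i).indicator (1 : Y → ℝ)) a x) →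
      1 ≤ Finsupp.linearCombination ℝ w a) :
    ∃ μ : Measure Y, IsProbabilityMeasure μ ∧ μ K = 1 ∧ ∀ i, μ (U i) ≤ ENNReal.ofReal (w i) := by
  classical
  set cov : (ι →₀ ℝ) →ₗ[ℝ] (Y → ℝ) :=
    Finsupp.linearCombination ℝ (fun i => (U i).indicator (1 : Y → ℝ)) with hcov
  set cost : (ι →₀ ℝ) →ₗ[ℝ] ℝ := Finsupp.linearCombination ℝ w with hcostdef
  have cost_nonneg : ∀ a : ι →₀ ℝ, (∀ i, 0 ≤ a i) → 0 ≤ cost a := fun a ha => by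
    rw [hcostdef, Finsupp.linearCombination_apply]
    exact Finset.sum_nonneg fun i _ => mul_nonneg (ha i) (hw i)
  let S : C(Y, ℝ) → Set ℝ := fun f =>
    {r | ∃ a : ι →₀ ℝ, (∀ i, 0 ≤ a i) ∧ (∀ x ∈ K, f x ≤ cov a x) ∧ cost a = r}
  have S_bdd : ∀ f, BddBelow (S f) := fun f =>
    ⟨0, by rintro _ ⟨a, ha, -, rfl⟩; exact cost_nonneg a ha⟩
  have S_ne : ∀ f, (S f).Nonempty := fun f => by
    obtain ⟨t, ht⟩ := hK.elim_finite_subcover U hU hKU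
    obtain ⟨M, hM0, hM⟩ : ∃ M : ℝ, 0 ≤ M ∧ ∀ x, f x ≤ M :=
      ⟨‖f‖, norm_nonneg f, f.apply_le_norm⟩
    refine ⟨_, ∑ i ∈ t, Finsupp.single i M, fun i => ?_, fun x hx => ?_, rfl⟩
    · rw [Finsupp.finsetSum_apply]
      exact Finset.sum_nonneg fun j _ => by
        rw [Finsupp.single_apply]; split_ifs <;> simp [hM0]
    · obtain ⟨i, hi, hxi⟩ := mem_iUnion₂.1 (ht hx)
      rw [map_sum, Finset.sum_apply]
      have h1 : f x ≤ cov (Finsupp.single i M) x := by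
        simpa [hcov, hxi] using hM x
      refine h1.trans
        (Finset.single_le_sum (f := fun j => cov (Finsupp.single j M) x) (fun j _ => ?_) hi)
      simp only [hcov, Finsupp.linearCombination_single, Pi.smul_apply, smul_eq_mul]
      exact mul_nonneg hM0 (indicator_nonneg (by simp) _)
  let p : C(Y, ℝ) → ℝ := fun f => sInf (S f)
  have p_nonneg : ∀ f, 0 ≤ p f := fun f =>
    le_csInf (S_ne f) (by rintro _ ⟨a, ha, -, rfl⟩; exact cost_nonneg a ha)
  have p_le : ∀ f (a : ι →₀ ℝ), (∀ i, 0 ≤ a i) → (∀ x ∈ K, f x ≤ cov a x) → p f ≤ cost a :=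
    fun f a ha h => csInf_le (S_bdd f) ⟨a, ha, h, rfl⟩
  have p_hom : ∀ c : ℝ, 0 < c → ∀ f, p (c • f) = c * p f := fun c hc f => by
    have : S (c • f) = c • S f := by
      ext r
      rw [Set.mem_smul_set]
      constructor
      · rintro ⟨a, ha, h, rfl⟩
        refine ⟨_, ⟨c⁻¹ • a, fun i => ?_, fun x hx => ?_, rfl⟩, ?_⟩
        · exact mul_nonneg (inv_nonneg.2 hc.le) (ha i)
        · have := h x hx
          simp only [ContinuousMap.smul_apply, smul_eq_mul, map_smul, Pi.smul_apply] at this ⊢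
          rwa [le_inv_mul_iff₀ hc]
        · rw [map_smul, smul_smul, mul_inv_cancel₀ hc.ne', one_smul]
      · rintro ⟨_, ⟨a, ha, h, rfl⟩, rfl⟩
        refine ⟨c • a, fun i => mul_nonneg hc.le (ha i), fun x hx => ?_, map_smul _ _ _⟩
        simp only [ContinuousMap.smul_apply, smul_eq_mul, map_smul, Pi.smul_apply]
        exact mul_le_mul_of_nonneg_left (h x hx) hc.le
    change sInf _ = _
    rw [this, Real.sInf_smul_of_nonneg hc.le, smul_eq_mul]
  have p_add : ∀ f g, p (f + g) ≤ p f + p g := fun f g => by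
    change _ ≤ sInf (S f) + sInf (S g)
    rw [← csInf_add (S_ne f) (S_bdd f) (S_ne g) (S_bdd g)]
    refine csInf_le_csInf (S_bdd _) ((S_ne f).add (S_ne g)) ?_
    rintro _ ⟨_, ⟨a, ha, hfa, rfl⟩, _, ⟨b, hb, hgb, rfl⟩, rfl⟩
    refine ⟨a + b, fun i => add_nonneg (ha i) (hb i), fun x hx => ?_, map_add _ _ _⟩
    rw [map_add]
    exact add_le_add (hfa x hx) (hgb x hx)
  have p_one : ∀ c : ℝ, c ≤ p (c • (1 : C(Y, ℝ))) := fun c => by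
    rcases le_or_gt c 0 with hc | hc
    · exact hc.trans (p_nonneg _)
    · rw [p_hom c hc]
      refine le_mul_of_one_le_right hc.le (le_csInf (S_ne _) ?_)
      rintro _ ⟨a, ha, h, rfl⟩
      exact hcost a ha h
  have hinj : ∀ c : ℝ, c • (1 : C(Y, ℝ)) = 0 → RingHom.id ℝ c • (1 : ℝ) = 0 := fun c hc => by
    have h1 := p_one c
    have h2 := p_one (-c)
    have h0 : p 0 ≤ 0 := by
      simpa using p_le 0 0 (by simp) (by simp)
    rw [neg_smul, hc, neg_zero] at h2
    rw [hc] at h1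
    simp only [RingHom.id_apply, smul_eq_mul, mul_one]
    linarith
  obtain ⟨L, hL1, hLp⟩ := exists_extension_of_le_sublinear
    (LinearPMap.mkSpanSingleton' (1 : C(Y, ℝ)) (1 : ℝ) hinj) p p_hom p_add (by
      rintro ⟨x, hx⟩
      obtain ⟨c, rfl⟩ := Submodule.mem_span_singleton.1 hx
      rw [LinearPMap.mkSpanSingleton'_apply]
      simpa using p_one c)
  have hLone : L 1 = 1 :=
    (hL1 ⟨1, Submodule.mem_span_singleton_self _⟩).trans
      (LinearPMap.mkSpanSingleton'_apply_self _ _ _ _)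
  have hLpos : ∀ f : C(Y, ℝ), (∀ x, 0 ≤ f x) → 0 ≤ L f := fun f hf => by
    have h := (hLp (-f)).trans (p_le (-f) 0 (by simp) (by simpa using fun x _ => hf x))
    rw [map_neg, map_zero] at h
    linarith
  let Λ : C_c(Y, ℝ) →ₚ[ℝ] ℝ := PositiveLinearMap.mk₀
    { toFun := fun f => L f.toContinuousMap
      map_add' := fun f g => L.map_add f.toContinuousMap g.toContinuousMap
      map_smul' := fun c f => L.map_smul c f.toContinuousMap }
    (fun f hf => hLpos _ fun x => hf x)
  have hΛ : ∀ f : C(Y, ℝ), Λ (CompactlySupportedContinuousMap.continuousMapEquiv f) = L f :=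
    fun f => rfl
  set μ := RealRMK.rieszMeasure Λ with hμ
  have hint : ∫ _, (1 : ℝ) ∂μ = 1 := by
    have := RealRMK.integral_rieszMeasure Λ (CompactlySupportedContinuousMap.continuousMapEquiv 1)
    rw [hΛ, hLone] at this
    simpa using this
  have hprob : IsProbabilityMeasure μ := by
    rw [integral_const, smul_eq_mul, mul_one, Measure.real, ENNReal.toReal_eq_one_iff] at hint
    exact ⟨hint⟩
  have hopen : ∀ (V : Set Y), IsOpen V → ∀ a : ι →₀ ℝ, (∀ i, 0 ≤ a i) →
      (∀ x ∈ K, V.indicator 1 x ≤ cov a x) → μ V ≤ ENNReal.ofReal (cost a) := by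
    intro V hV a ha hVa
    rw [hV.measure_eq_iSup_isCompact]
    refine iSup₂_le fun C hCV => iSup_le fun hC => ?_
    obtain ⟨f, hf0, hf1, hf⟩ := exists_continuous_zero_one_of_isClosed hV.isClosed_compl
      hC.isClosed (disjoint_compl_left_iff_subset.2 hCV)
    refine (RealRMK.rieszMeasure_le_of_eq_one Λ
      (f := CompactlySupportedContinuousMap.continuousMapEquiv f) (fun x => (hf x).1) hC
      hf1).trans ?_
    rw [hΛ]
    refine ENNReal.ofReal_le_ofReal ((hLp f).trans (p_le f a ha fun x hx => le_trans ?_ (hVa x hx)))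
    by_cases hxV : x ∈ V
    · simpa [hxV] using (hf x).2
    · simpa [hxV] using (hf0 hxV).le
  refine ⟨μ, hprob, ?_, fun i => ?_⟩
  · rw [prob_compl_eq_zero_iff hK.measurableSet |>.symm]
    have := hopen Kᶜ hK.isClosed.isOpen_compl 0 (by simp) (by simp +contextual)
    simpa using this
  · have := hopen (U i) (hU i) (Finsupp.single i 1)
      (fun j => by rw [Finsupp.single_apply]; split_ifs <;> simp) (by simp [hcov])
    simpa [hcostdef] using this

end Duality

/-- Given finitely many weighted labels, each related by `r` to some points, and a set `Z` of points
whose related labels have total weight at least `t > 0`, at most `(total weight) / t` points suffice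
for every point of `Z` to share a label with one of them. -/
theorem exists_finset_card_mul_le_sum {α Y : Type*} (r : α → Y → Prop) (S : Finset α) (a : α → ℝ)
    (ha : ∀ p, 0 ≤ a p) {t : ℝ} (ht : 0 < t) (Z : Set Y)
    (hZ : ∀ y ∈ Z, t ≤ ∑ p ∈ S, {p | r p y}.indicator a p) :
    ∃ E : Finset Y, E.card * t ≤ ∑ p ∈ S, a p ∧ ∀ y ∈ Z, ∃ x ∈ E, ∃ p, r p x ∧ r p y := by
  classical
  let Separated : Finset Y → Prop := fun E =>
    (∀ y ∈ E, y ∈ Z) ∧ ∀ x ∈ E, ∀ y ∈ E, x ≠ y → ∀ p, r p x → ¬ r p y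
  have hind : ∀ p y, ¬ r p y → {p | r p y}.indicator a p = 0 := fun p y h =>
    indicator_of_notMem (s := {p | r p y}) h a
  have hcard : ∀ E, Separated E → E.card * t ≤ ∑ p ∈ S, a p := by
    rintro E ⟨hEZ, hE⟩
    calc E.card * t = ∑ y ∈ E, t := by simp
      _ ≤ ∑ y ∈ E, ∑ p ∈ S, {p | r p y}.indicator a p :=
          Finset.sum_le_sum fun y hy => hZ y (hEZ y hy)
      _ = ∑ p ∈ S, ∑ y ∈ E, {p | r p y}.indicator a p := Finset.sum_comm
      _ ≤ ∑ p ∈ S, a p := Finset.sum_le_sum fun p _ => ?_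
    by_cases h : ∃ x ∈ E, r p x
    · obtain ⟨x, hx, hpx⟩ := h
      rw [Finset.sum_eq_single_of_mem x hx fun y hy hyx =>
        hind p y (hE x hx y hy hyx.symm p hpx)]
      exact indicator_le_self' (fun _ _ => ha _) p
    · push Not at h
      rw [Finset.sum_eq_zero fun y hy => hind p y (h y hy)]
      exact ha p
  have hbdd : BddAbove (Finset.card '' {E | Separated E}) := by
    refine ⟨⌊(∑ p ∈ S, a p) / t⌋₊, ?_⟩
    rintro _ ⟨E, hE, rfl⟩
    exact Nat.le_floor ((le_div_iff₀ ht).2 (hcard E hE))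
  obtain ⟨E, hE, hEmax⟩ := Nat.sSup_mem (s := Finset.card '' {E | Separated E})
    ⟨0, ∅, ⟨by simp, by simp⟩, rfl⟩ hbdd
  refine ⟨E, hcard E hE, fun y hy => ?_⟩
  by_contra! hcon
  have hyE : y ∉ E := fun hyE => by
    have h0 : ∑ p ∈ S, {p | r p y}.indicator a p = 0 :=
      Finset.sum_eq_zero fun p _ => hind p y fun hp => hcon y hyE p hp hp
    linarith [hZ y hy]
  have hins : Separated (insert y E) := by
    refine ⟨fun z hz => ?_, fun x hx z hz hxz p hpx hpz => ?_⟩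
    · rcases Finset.mem_insert.1 hz with rfl | hz
      exacts [hy, hE.1 z hz]
    · rcases Finset.mem_insert.1 hx with rfl | hx' <;>
        rcases Finset.mem_insert.1 hz with rfl | hz'
      · exact hxz rfl
      · exact hcon z hz' p hpz hpx
      · exact hcon x hx' p hpx hpz
      · exact hE.2 x hx' z hz' hxz p hpx hpz
  have := le_csSup hbdd ⟨_, hins, rfl⟩
  rw [← hEmax, Finset.card_insert_of_notMem hyE] at this
  omega

namespace NDS

variable {X : ℕ → Type*} [∀ k, MetricSpace (X k)]

theorem bowenBall_anti_mono (T : ∀ k, X k → X (k + 1)) (n : ℕ) {ε ε' : ℝ} (h : ε ≤ ε') (x : X 0) :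
    bowenBall T n ε x ⊆ bowenBall T n ε' x :=
  fun _ hy j hj => (hy j hj).trans_le h

theorem mem_bowenBall_self (T : ∀ k, X k → X (k + 1)) (n : ℕ) {ε : ℝ} (h : 0 < ε) (x : X 0) :
    x ∈ bowenBall T n ε x :=
  fun j _ => by rwa [dist_self]

theorem mem_bowenBall_add {T : ∀ k, X k → X (k + 1)} {n : ℕ} {ε ε' : ℝ} {p x y : X 0}
    (hx : x ∈ bowenBall T n ε p) (hy : y ∈ bowenBall T n ε' p) :
    y ∈ bowenBall T n (ε + ε') x := fun j hj =>
  (dist_triangle_left _ _ _).trans_lt (add_lt_add (hx j hj) (hy j hj))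

theorem isOpen_bowenBall {T : ∀ k, X k → X (k + 1)} (hT : ∀ k, Continuous (T k)) (n : ℕ) (ε : ℝ)
    (x : X 0) : IsOpen (bowenBall T n ε x) := by
  have hiter : ∀ j, Continuous (iter T j) := fun j => by
    induction j with
    | zero => exact continuous_id
    | succ j ih => exact (hT j).comp ih
  have : bowenBall T n ε x = ⋂ j ∈ Finset.range n, {y | dist (iter T j x) (iter T j y) < ε} := by
    ext y; simp [bowenBall]
  rw [this]
  exact isOpen_biInter_finset fun j _ =>
    isOpen_lt (continuous_const.dist (hiter j)) continuous_const

/-- Zero-potential form of the definition of `bowenPre` as a lower bound over covers. -/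
theorem bowenPre_zero_le {T : ∀ k, X k → X (k + 1)} {s : ℝ} {N : ℕ} {ε : ℝ} {Z : Set (X 0)}
    {D : Set (X 0 × ℕ)} (hD : D.Countable) (hN : ∀ p ∈ D, N ≤ p.2)
    (hZ : Z ⊆ ⋃ p ∈ D, bowenBall T p.2 ε p.1) :
    bowenPre T (fun k => fun _ : X k => (0 : ℝ)) s N ε Z ≤
      ∑' p : D, ENNReal.ofReal (Real.exp (-(p.1.2 : ℝ) * s)) := by
  refine (iInf_le_of_le D <| iInf_le_of_le hD <| iInf_le_of_le hN <| iInf_le_of_le hZ ?_)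
  simp [birk]

theorem le_bowenPre_zero {T : ∀ k, X k → X (k + 1)} {s : ℝ} {N : ℕ} {ε : ℝ} {Z : Set (X 0)}
    {b : ℝ≥0∞} (h : ∀ D : Set (X 0 × ℕ), D.Countable → (∀ p ∈ D, N ≤ p.2) →
      (Z ⊆ ⋃ p ∈ D, bowenBall T p.2 ε p.1) →
      b ≤ ∑' p : D, ENNReal.ofReal (Real.exp (-(p.1.2 : ℝ) * s))) :
    b ≤ bowenPre T (fun k => fun _ : X k => (0 : ℝ)) s N ε Z := by
  refine le_iInf fun D => le_iInf fun hD => le_iInf fun hN => le_iInf fun hZ => ?_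
  simpa [birk] using h D hD hN hZ

/-- Weighted covers by Bowen balls of radius `ε` are, up to an exponential loss `δ`, no cheaper
than plain covers by Bowen balls of radius `2ε`. -/
theorem bowenPre_le_weighted_cover (T : ∀ k, X k → X (k + 1)) {s δ ε : ℝ} {N : ℕ}
    (hN : ∀ F : Finset ℕ, ∑ n ∈ F, Real.exp (-((N + n : ℕ) : ℝ) * δ) < 1) {K : Set (X 0)}
    (a : X 0 × ℕ →₀ ℝ) (ha : ∀ p, 0 ≤ a p)
    (hcov : ∀ x ∈ K, 1 ≤ Finsupp.linearCombination ℝ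
      (fun p : X 0 × ℕ => (bowenBall T (N + p.2) ε p.1).indicator (1 : X 0 → ℝ)) a x) :
    bowenPre T (fun k => fun _ : X k => (0 : ℝ)) (s + δ) N (ε + ε) K ≤
      ENNReal.ofReal (Finsupp.linearCombination ℝ
        (fun p : X 0 × ℕ => Real.exp (-((N + p.2 : ℕ) : ℝ) * s)) a) := by
  classical
  let F : Finset ℕ := a.support.image Prod.snd
  let S : ℕ → Finset (X 0 × ℕ) := fun n => a.support.filter fun p => p.2 = n
  have hSF : ∀ f : X 0 × ℕ → ℝ, ∑ n ∈ F, ∑ p ∈ S n, f p = ∑ p ∈ a.support, f p := fun f =>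
    Finset.sum_fiberwise_of_maps_to (fun p hp => Finset.mem_image_of_mem _ hp) f
  let t : ℕ → ℝ := fun n => Real.exp (-((N + n : ℕ) : ℝ) * δ)
  let r : ℕ → X 0 × ℕ → X 0 → Prop := fun n p y => y ∈ bowenBall T (N + n) ε p.1
  choose E hEcard hEcov using fun n => exists_finset_card_mul_le_sum (r n) (S n) a ha
    (Real.exp_pos _ : 0 < t n) {y | t n ≤ ∑ p ∈ S n, {p | r n p y}.indicator a p} (fun y hy => hy)
  let D : Finset (X 0 × ℕ) := F.biUnion fun n => (E n).image fun x => (x, N + n)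
  have hDcov : K ⊆ ⋃ p ∈ (D : Set (X 0 × ℕ)), bowenBall T p.2 (ε + ε) p.1 := by
    intro y hy
    obtain ⟨n, hnF, hn⟩ : ∃ n ∈ F, t n ≤ ∑ p ∈ S n, {p | r n p y}.indicator a p := by
      by_contra! hcon
      have h1 := hcov y hy
      rw [Finsupp.linearCombination_apply, Finsupp.sum, Finset.sum_apply, ← hSF] at h1
      have h2 : ∑ n ∈ F, ∑ p ∈ S n,
          (a p • (bowenBall T (N + p.2) ε p.1).indicator (1 : X 0 → ℝ)) y ≤ ∑ n ∈ F, t n := by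
        refine Finset.sum_le_sum fun n hn => (le_of_eq ?_).trans (hcon n hn).le
        refine Finset.sum_congr rfl fun p hp => ?_
        obtain rfl : p.2 = n := (Finset.mem_filter.1 hp).2
        by_cases hpy : y ∈ bowenBall T (N + p.2) ε p.1 <;> simp [r, hpy]
      linarith [hN F]
    obtain ⟨x, hx, p, hpx, hpy⟩ := hEcov n y hn
    refine mem_iUnion₂.2 ⟨(x, N + n), ?_, mem_bowenBall_add hpx hpy⟩
    exact Finset.mem_coe.2 (Finset.mem_biUnion.2 ⟨n, hnF, Finset.mem_image_of_mem _ hx⟩)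
  refine (bowenPre_zero_le D.countable_toSet ?_ hDcov).trans ?_
  · intro p hp
    obtain ⟨n, -, hp⟩ := Finset.mem_biUnion.1 (Finset.mem_coe.1 hp)
    obtain ⟨x, -, rfl⟩ := Finset.mem_image.1 hp
    exact Nat.le_add_right _ _
  rw [Finset.tsum_subtype' D fun p => ENNReal.ofReal (Real.exp (-(p.2 : ℝ) * (s + δ))),
    ← ENNReal.ofReal_sum_of_nonneg fun p _ => (Real.exp_pos _).le]
  refine ENNReal.ofReal_le_ofReal ?_
  calc ∑ p ∈ D, Real.exp (-(p.2 : ℝ) * (s + δ))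
      = ∑ n ∈ F, ∑ p ∈ (E n).image fun x => (x, N + n), Real.exp (-(p.2 : ℝ) * (s + δ)) := by
        refine Finset.sum_biUnion fun m _ n _ hmn => Finset.disjoint_left.2 fun p hm hn => hmn ?_
        obtain ⟨x, -, rfl⟩ := Finset.mem_image.1 hm
        obtain ⟨y, -, hy⟩ := Finset.mem_image.1 hn
        exact (Nat.add_left_cancel (Prod.mk.inj hy).2).symm
    _ ≤ ∑ n ∈ F, ∑ p ∈ S n, a p * Real.exp (-((N + p.2 : ℕ) : ℝ) * s) := by
        refine Finset.sum_le_sum fun n _ => ?_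
        rw [Finset.sum_image fun x _ y _ h => (Prod.mk.inj h).1]
        dsimp only
        rw [Finset.sum_const, nsmul_eq_mul,
          mul_add, Real.exp_add, mul_comm (Real.exp _), ← mul_assoc]
        refine (mul_le_mul_of_nonneg_right (hEcard n) (Real.exp_pos _).le).trans (le_of_eq ?_)
        rw [Finset.sum_mul]
        refine Finset.sum_congr rfl fun p hp => ?_
        rw [(Finset.mem_filter.1 hp).2]
    _ = _ := by
        rw [hSF, Finsupp.linearCombination_apply]; rfl

theorem elog_le_coe_iff {x : ℝ≥0∞} {r : ℝ} :
    elog x ≤ (r : EReal) ↔ x ≤ ENNReal.ofReal (Real.exp r) := by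
  have : elog x = ENNReal.log x := rfl
  rw [this, ← ENNReal.log_le_log_iff, ENNReal.log_ofReal_of_pos (Real.exp_pos r), Real.log_exp]

theorem ofENN_eq_coe (x : ℝ≥0∞) : ofENN x = (x : EReal) := by
  unfold ofENN
  split_ifs with h
  · rw [h, EReal.coe_ennreal_top]
  · lift x to NNReal using h
    rfl

theorem toENN_eq_toENNReal (x : EReal) : toENN x = x.toENNReal := rfl

theorem bowenPre_zero_anti (T : ∀ k, X k → X (k + 1)) {s t : ℝ} (hst : s ≤ t) (N : ℕ) (ε : ℝ)
    (Z : Set (X 0)) :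
    bowenPre T (fun k => fun _ : X k => (0 : ℝ)) t N ε Z ≤
      bowenPre T (fun k => fun _ : X k => (0 : ℝ)) s N ε Z := by
  refine le_bowenPre_zero fun D hD hN hZ => (bowenPre_zero_le hD hN hZ).trans ?_
  refine ENNReal.tsum_le_tsum fun p => ENNReal.ofReal_le_ofReal (Real.exp_le_exp.2 ?_)
  exact mul_le_mul_of_nonpos_left hst (neg_nonpos.2 (Nat.cast_nonneg _))

theorem bowenPre_zero_mono (T : ∀ k, X k → X (k + 1)) (s : ℝ) {M N : ℕ} (hMN : M ≤ N) (ε : ℝ)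
    (Z : Set (X 0)) :
    bowenPre T (fun k => fun _ : X k => (0 : ℝ)) s M ε Z ≤
      bowenPre T (fun k => fun _ : X k => (0 : ℝ)) s N ε Z :=
  le_bowenPre_zero fun _ hD hN hZ => bowenPre_zero_le hD (fun p hp => hMN.trans (hN p hp)) hZ

theorem coe_le_bowenEnt {T : ∀ k, X k → X (k + 1)} {s : ℝ} {N : ℕ} {ε : ℝ} (hε : 0 < ε)
    {Z : Set (X 0)} (h : bowenPre T (fun k => fun _ : X k => (0 : ℝ)) s N ε Z ≠ 0) :
    (s : EReal) ≤ bowenEnt T Z := by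
  refine le_iSup₂_of_le ε hε (le_iInf₂ fun t ht => EReal.coe_le_coe_iff.2 ?_)
  by_contra! hts
  refine h (le_antisymm ?_ zero_le)
  rw [← ht]
  exact (bowenPre_zero_anti T hts.le N ε Z).trans
    (le_iSup (fun N => bowenPre T (fun k => fun _ : X k => (0 : ℝ)) t N ε Z) N)

theorem exists_bowenPre_ne_zero {T : ∀ k, X k → X (k + 1)} {s : ℝ} {Z : Set (X 0)}
    (h : (s : EReal) < bowenEnt T Z) : ∃ ε > 0, ∃ r > s, ∃ N,
      bowenPre T (fun k => fun _ : X k => (0 : ℝ)) r N ε Z ≠ 0 := by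
  obtain ⟨ε, hε, h⟩ := lt_iSup_iff.1 h |>.imp fun _ => lt_iSup_iff.1
  obtain ⟨r, hsr, hr⟩ := EReal.lt_iff_exists_real_btwn.1 h
  refine ⟨ε, hε, r, EReal.coe_lt_coe_iff.1 hsr, ?_⟩
  by_contra! hcon
  exact hr.not_ge (iInf₂_le r (ENNReal.iSup_eq_zero.2 hcon))

/-- The mass distribution principle for Bowen balls. -/
theorem measure_le_bowenPre [MeasurableSpace (X 0)] (μ : Measure (X 0))
    (T : ∀ k, X k → X (k + 1)) {s : ℝ} {N : ℕ} {ε : ℝ} {A Z : Set (X 0)} (hAZ : A ⊆ Z)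
    (h : ∀ x ∈ A, ∀ n ≥ N, μ (bowenBall T n (ε + ε) x) ≤
      ENNReal.ofReal (Real.exp (-(n : ℝ) * s))) :
    μ A ≤ bowenPre T (fun k => fun _ : X k => (0 : ℝ)) s N ε Z := by
  refine le_bowenPre_zero fun D hD hN hZ => ?_
  have hA : A ⊆ ⋃ p ∈ D, A ∩ bowenBall T p.2 ε p.1 := fun x hx => by
    obtain ⟨p, hp, hxp⟩ := mem_iUnion₂.1 (hZ (hAZ hx))
    exact mem_iUnion₂.2 ⟨p, hp, hx, hxp⟩
  refine (measure_mono hA).trans ((measure_biUnion_le μ hD _).trans ?_)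
  refine ENNReal.tsum_le_tsum fun p => ?_
  rcases (A ∩ bowenBall T p.1.2 ε p.1.1).eq_empty_or_nonempty with he | ⟨x, hxA, hxp⟩
  · rw [he, measure_empty]; exact zero_le
  · exact (measure_mono fun y hy => mem_bowenBall_add hxp hy.2).trans (h x hxA _ (hN _ p.2))

theorem localLowerEnt_nonneg [MeasurableSpace (X 0)] (μ : Measure (X 0)) [IsProbabilityMeasure μ]
    (T : ∀ k, X k → X (k + 1)) (x : X 0) : 0 ≤ localLowerEnt μ T x := by
  refine le_iSup₂_of_le 1 one_pos (le_liminf_of_le (by isBoundedDefault)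
    (Eventually.of_forall fun n => mul_nonneg (EReal.coe_nonneg.2 (by positivity)) ?_))
  rw [EReal.le_neg, neg_zero]
  rw [← EReal.coe_zero, elog_le_coe_iff, Real.exp_zero, ENNReal.ofReal_one]
  exact prob_le_one

theorem coe_le_localLowerEnt [MeasurableSpace (X 0)] {μ : Measure (X 0)}
    {T : ∀ k, X k → X (k + 1)} {x : X 0} {s c ε : ℝ} {N : ℕ} (hc : 0 < c) (hε : 0 < ε)
    (h : ∀ n ≥ N, μ (bowenBall T n ε x) ≤ ENNReal.ofReal (Real.exp (-(n : ℝ) * s) / c)) :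
    (s : EReal) ≤ localLowerEnt μ T x := by
  refine le_iSup₂_of_le ε hε ?_
  have hlim : Tendsto (fun n : ℕ => ((s + (n : ℝ)⁻¹ * Real.log c : ℝ) : EReal)) atTop
      (𝓝 (s : EReal)) := by
    refine (continuous_coe_real_ereal.tendsto s).comp ?_
    simpa using tendsto_const_nhds.add (tendsto_inv_atTop_nhds_zero_nat.mul_const (Real.log c))
  rw [← hlim.liminf_eq]
  refine liminf_le_liminf ?_
  filter_upwards [eventually_ge_atTop N, eventually_ge_atTop 1] with n hn hn1
  have hn0 : (n : ℝ) ≠ 0 := by positivity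
  have h1 : elog (μ (bowenBall T n ε x)) ≤ ((-(n * s + Real.log c) : ℝ) : EReal) := by
    rw [elog_le_coe_iff]
    refine (h n hn).trans_eq ?_
    rw [neg_add, Real.exp_add, Real.exp_neg (Real.log c), Real.exp_log hc, neg_mul, div_eq_mul_inv]
  have h2 : ((n * s + Real.log c : ℝ) : EReal) ≤ -elog (μ (bowenBall T n ε x)) := by
    rw [EReal.le_neg]
    exact_mod_cast h1
  calc ((s + (n : ℝ)⁻¹ * Real.log c : ℝ) : EReal)
      = (((n : ℝ)⁻¹ : ℝ) : EReal) * ((n * s + Real.log c : ℝ) : EReal) := by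
        rw [← EReal.coe_mul, mul_add, inv_mul_cancel_left₀ hn0]
    _ ≤ _ := mul_le_mul_of_nonneg_left h2 (EReal.coe_nonneg.2 (by positivity))

theorem exists_measure_bowenBall_le [MeasurableSpace (X 0)] {μ : Measure (X 0)}
    {T : ∀ k, X k → X (k + 1)} {x : X 0} {s : ℝ} (h : (s : EReal) < localLowerEnt μ T x) :
    ∃ k N : ℕ, ∀ n ≥ N, μ (bowenBall T n (1 / ((k : ℝ) + 1)) x) ≤
      ENNReal.ofReal (Real.exp (-(n : ℝ) * s)) := by
  obtain ⟨ε, hε, h⟩ := lt_iSup_iff.1 h |>.imp fun _ => lt_iSup_iff.1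
  obtain ⟨k, hk⟩ := exists_nat_one_div_lt hε
  obtain ⟨N, hN⟩ := eventually_atTop.1
    ((eventually_lt_of_lt_liminf h).and (eventually_ge_atTop 1))
  refine ⟨k, N, fun n hn => (measure_mono (bowenBall_anti_mono T n hk.le x)).trans ?_⟩
  obtain ⟨hsn, hn1⟩ := hN n hn
  have hn0 : (n : ℝ) ≠ 0 := by positivity
  rw [← elog_le_coe_iff]
  by_contra! hcon
  refine hsn.not_ge ?_
  have h2 : -elog (μ (bowenBall T n ε x)) ≤ ((n * s : ℝ) : EReal) := by
    rw [EReal.neg_le]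
    refine le_trans (le_of_eq ?_) hcon.le
    rw [← EReal.coe_neg, neg_mul]
  calc _ ≤ (((n : ℝ)⁻¹ : ℝ) : EReal) * ((n * s : ℝ) : EReal) :=
        mul_le_mul_of_nonneg_left h2 (EReal.coe_nonneg.2 (by positivity))
    _ = s := by rw [← EReal.coe_mul, inv_mul_cancel_left₀ hn0]

theorem coe_le_lowerEnt [MeasurableSpace (X 0)] {μ : Measure (X 0)} [IsProbabilityMeasure μ]
    {T : ∀ k, X k → X (k + 1)} {s : ℝ} (h : ∀ x, (s : EReal) ≤ localLowerEnt μ T x) :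
    (s : EReal) ≤ lowerEnt μ T := by
  have hneg : ∀ x, toENN (-localLowerEnt μ T x) = 0 := fun x => by
    rw [toENN_eq_toENNReal, EReal.toENNReal_eq_zero_iff, EReal.neg_le, neg_zero]
    exact localLowerEnt_nonneg μ T x
  have hpos : ENNReal.ofReal s ≤ ∫⁻ x, toENN (localLowerEnt μ T x) ∂μ := by
    calc ENNReal.ofReal s = ∫⁻ _, ENNReal.ofReal s ∂μ := by simp
      _ ≤ _ := lintegral_mono fun x => by
        simpa [toENN_eq_toENNReal] using EReal.toENNReal_le_toENNReal (h x)
  simp only [lowerEnt, eInt, hneg, lintegral_zero, ofENN_eq_coe, EReal.coe_ennreal_zero, sub_zero]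
  refine le_trans ?_ (EReal.coe_ennreal_le_coe_ennreal_iff.2 hpos)
  rw [EReal.coe_ennreal_ofReal]
  exact EReal.coe_le_coe_iff.2 (le_max_left _ _)

theorem measure_lt_localLowerEnt_ne_zero [MeasurableSpace (X 0)] {μ : Measure (X 0)}
    [IsProbabilityMeasure μ] {T : ∀ k, X k → X (k + 1)} {s : ℝ} (h : (s : EReal) < lowerEnt μ T) :
    μ {x | (s : EReal) < localLowerEnt μ T x} ≠ 0 := by
  intro h0
  have hae : ∀ᵐ x ∂μ, localLowerEnt μ T x ≤ s := by
    simpa [ae_iff] using h0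
  obtain ⟨x, hx⟩ := hae.exists
  have hs : 0 ≤ s := EReal.coe_nonneg.1 ((localLowerEnt_nonneg μ T x).trans hx)
  have hint : ∫⁻ x, toENN (localLowerEnt μ T x) ∂μ ≤ ENNReal.ofReal s := by
    calc _ ≤ ∫⁻ _, ENNReal.ofReal s ∂μ := lintegral_mono_ae (hae.mono fun x hx => by
          simpa [toENN_eq_toENNReal] using EReal.toENNReal_le_toENNReal hx)
      _ = _ := by simp
  refine h.not_ge ?_
  simp only [lowerEnt, eInt, ofENN_eq_coe]
  refine (EReal.sub_le_sub (EReal.coe_ennreal_le_coe_ennreal_iff.2 hint)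
    (EReal.coe_ennreal_nonneg _)).trans ?_
  rw [sub_zero, EReal.coe_ennreal_ofReal, max_eq_left hs]

theorem lowerEnt_le_bowenEnt [MeasurableSpace (X 0)] {μ : Measure (X 0)} [IsProbabilityMeasure μ]
    (T : ∀ k, X k → X (k + 1)) {K : Set (X 0)} (hK : μ Kᶜ = 0) :
    lowerEnt μ T ≤ bowenEnt T K := by
  refine EReal.ge_of_forall_gt_iff_ge.1 fun s hs => ?_
  have hne := measure_lt_localLowerEnt_ne_zero hs
  let A : ℕ → ℕ → Set (X 0) := fun k N =>
    {x ∈ K | ∀ n ≥ N, μ (bowenBall T n (1 / ((k : ℝ) + 1)) x) ≤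
      ENNReal.ofReal (Real.exp (-(n : ℝ) * s))}
  have hsub : {x | (s : EReal) < localLowerEnt μ T x} ⊆ Kᶜ ∪ ⋃ k, ⋃ N, A k N := fun x hx => by
    by_cases hxK : x ∈ K
    · obtain ⟨k, N, h⟩ := exists_measure_bowenBall_le hx
      exact Or.inr (mem_iUnion₂.2 ⟨k, N, hxK, h⟩)
    · exact Or.inl hxK
  obtain ⟨k, N, hkN⟩ : ∃ k N, μ (A k N) ≠ 0 := by
    by_contra! hcon
    exact hne (measure_mono_null hsub (measure_union_null hK
      (measure_iUnion_null fun k => measure_iUnion_null fun N => hcon k N)))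
  have hε : 0 < 1 / ((k : ℝ) + 1) / 2 := by positivity
  refine coe_le_bowenEnt (N := N) hε fun h0 => hkN ?_
  refine le_antisymm ((measure_le_bowenPre μ T (fun x hx => hx.1) fun x hx n hn => ?_).trans_eq h0)
    zero_le
  rw [add_halves]
  exact hx.2 n hn

theorem exists_forall_sum_exp_lt_one {δ : ℝ} (hδ : 0 < δ) :
    ∃ M : ℕ, ∀ N ≥ M, ∀ F : Finset ℕ, ∑ n ∈ F, Real.exp (-((N + n : ℕ) : ℝ) * δ) < 1 := by
  have hq0 : 0 ≤ Real.exp (-δ) := (Real.exp_pos _).le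
  have hq1 : Real.exp (-δ) < 1 := Real.exp_lt_one_iff.2 (neg_lt_zero.2 hδ)
  obtain ⟨M, hM⟩ := exists_pow_lt_of_lt_one (sub_pos.2 hq1) hq1
  refine ⟨M, fun N hN F => ?_⟩
  have hexp : ∀ n : ℕ, Real.exp (-((N + n : ℕ) : ℝ) * δ) =
      Real.exp (-δ) ^ N * Real.exp (-δ) ^ n := fun n => by
    rw [← pow_add, ← Real.exp_nat_mul]; ring_nf
  simp only [hexp]
  rw [← Finset.mul_sum]
  have h1 : ∑ n ∈ F, Real.exp (-δ) ^ n ≤ (1 - Real.exp (-δ))⁻¹ :=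
    sum_le_hasSum F (fun n _ => pow_nonneg hq0 n) (hasSum_geometric_of_lt_one hq0 hq1)
  have h2 : Real.exp (-δ) ^ N < 1 - Real.exp (-δ) :=
    (pow_le_pow_of_le_one hq0 hq1.le hN).trans_lt hM
  have h3 := inv_pos.2 (sub_pos.2 hq1)
  calc _ ≤ Real.exp (-δ) ^ N * (1 - Real.exp (-δ))⁻¹ :=
        mul_le_mul_of_nonneg_left h1 (pow_nonneg hq0 N)
    _ < (1 - Real.exp (-δ)) * (1 - Real.exp (-δ))⁻¹ := mul_lt_mul_of_pos_right h2 h3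
    _ = 1 := mul_inv_cancel₀ (sub_pos.2 hq1).ne'

theorem exists_coe_le_lowerEnt [CompactSpace (X 0)] [MeasurableSpace (X 0)] [BorelSpace (X 0)]
    {T : ∀ k, X k → X (k + 1)} (hT : ∀ k, Continuous (T k)) {K : Set (X 0)} (hK : IsCompact K)
    {s : ℝ} (hs : (s : EReal) < bowenEnt T K) :
    ∃ μ : Measure (X 0), (IsProbabilityMeasure μ ∧ μ K = 1) ∧ (s : EReal) ≤ lowerEnt μ T := by
  obtain ⟨ε, hε, r, hr, N₀, hN₀⟩ := exists_bowenPre_ne_zero hs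
  obtain ⟨M, hM⟩ := exists_forall_sum_exp_lt_one (sub_pos.2 hr)
  let N := max N₀ M
  let b := bowenPre T (fun k => fun _ : X k => (0 : ℝ)) r N ε K
  have hb : b ≠ 0 := fun h0 => hN₀ (le_antisymm
    ((bowenPre_zero_mono T r (le_max_left N₀ M) ε K).trans_eq h0) zero_le)
  obtain ⟨c, hc, hcb⟩ : ∃ c : ℝ, 0 < c ∧ ENNReal.ofReal c ≤ b := by
    obtain ⟨q, hq0, hqb⟩ := ENNReal.lt_iff_exists_nnreal_btwn.1 (pos_iff_ne_zero.2 hb)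
    exact ⟨q, by exact_mod_cast hq0, by simpa using hqb.le⟩
  obtain ⟨μ, hμ, hμK, hμU⟩ := exists_measure_le_of_weighted_cover hK
    (fun p : X 0 × ℕ => bowenBall T (N + p.2) (ε / 2) p.1)
    (fun p => isOpen_bowenBall hT _ _ _)
    (fun x _ => mem_iUnion.2 ⟨(x, 0), mem_bowenBall_self T _ (half_pos hε) x⟩)
    (fun p => Real.exp (-((N + p.2 : ℕ) : ℝ) * s) / c) (fun p => by positivity)
    (fun a ha hcov => by
      have h := bowenPre_le_weighted_cover T (s := s) (hM N (le_max_right _ _)) a ha hcov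
      rw [add_halves, add_sub_cancel] at h
      have h' := hcb.trans h
      have hnn : 0 ≤ Finsupp.linearCombination ℝ
          (fun p : X 0 × ℕ => Real.exp (-((N + p.2 : ℕ) : ℝ) * s)) a := by
        rw [Finsupp.linearCombination_apply]
        exact Finset.sum_nonneg fun p _ => mul_nonneg (ha p) (Real.exp_pos _).le
      rw [ENNReal.ofReal_le_ofReal_iff hnn, Finsupp.linearCombination_apply, Finsupp.sum] at h'
      rw [Finsupp.linearCombination_apply, Finsupp.sum]
      simp only [smul_eq_mul, ← mul_div_assoc] at h' ⊢
      rwa [← Finset.sum_div, one_le_div hc])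
  refine ⟨μ, ⟨hμ, hμK⟩, coe_le_lowerEnt fun x =>
    coe_le_localLowerEnt (N := N) hc (half_pos hε) fun n hn => ?_⟩
  obtain ⟨m, rfl⟩ := Nat.exists_eq_add_of_le hn
  exact hμU (x, m)

end NDS

open NDS in
/-- Variational principle for the Bowen entropy.
For a non-empty compact `K ⊆ X 0`,
`h^B(T,K) = sup { h̲_μ(T) : μ Borel probability measure on X 0 with μ(K) = 1 }`. -/
theorem stmt3 {X : ℕ → Type*} [∀ k, MetricSpace (X k)] [∀ k, CompactSpace (X k)]
    [MeasurableSpace (X 0)] [BorelSpace (X 0)]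
    (T : ∀ k, X k → X (k + 1)) (hT : ∀ k, Continuous (T k))
    (K : Set (X 0)) (hK : IsCompact K) (hKne : K.Nonempty) :
    bowenEnt T K =
      ⨆ (μ : MeasureTheory.Measure (X 0))
        (_ : MeasureTheory.IsProbabilityMeasure μ ∧ μ K = 1), lowerEnt μ T := by
  refine le_antisymm (EReal.ge_of_forall_gt_iff_ge.1 fun s hs => ?_)
    (iSup₂_le fun μ hμ => ?_)
  · obtain ⟨μ, hμ, h⟩ := exists_coe_le_lowerEnt hT hK hs
    exact h.trans (le_iSup₂_of_le μ hμ le_rfl)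
  · have := hμ.1
    exact lowerEnt_le_bowenEnt T ((prob_compl_eq_zero_iff hK.measurableSet).2 hμ.2)
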